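/- arXiv:1407.1426 — 2 statements merged into one kernel-verified Lean document; each statement's English description precedes it below -/
import Mathlib

section
/- Let d ≥ 1, let μ : ℝ^d → ℝ^d and C : ℝ^d → (symmetric positive-definite d×d real matrices) be smooth, and let f : ℝ^d → ℝ be smooth. Define 𝓛f = ∑_i μ_i ∂_i f + ½ ∑_{i,j} C_{ij} ∂_i ∂_j f and 𝓛*f = −∑_i ∂_i(μ_i f) + ½ ∑_{i,j} ∂_i ∂_j (C_{ij} f), set ρ(x) = (det C(x))^{1/2} and Δ̂f := ρ·∑_i ∂_i( ρ⁻¹ ∑_j C_{ij} ∂_j f ). Then at every point of ℝ^d: (𝓛f + 𝓛*f) − f·(𝓛1 + 𝓛*1) = Δ̂f + ρ⁻¹·∑_{i,j} C_{ij}·(∂_i f)·(∂_j ρ), where 𝓛1 + 𝓛*1 = −∑_i ∂_i μ_i + ½ ∑_{i,j} ∂_i ∂_j C_{ij} is the result of applying 𝓛 + 𝓛* to the constant function 1. (Euclidean-coordinate form of the lemma expressing 𝓛 + 𝓛* as Δ_ĝ f + ∇_ĝ f · ∇_ĝ ρ / ρ plus a zeroth-order term.) -/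
open Matrix

/-- Partial derivative in the `i`-th coordinate direction. -/
noncomputable def pd {d : ℕ} (i : Fin d) (g : (Fin d → ℝ) → ℝ) (x : Fin d → ℝ) : ℝ :=
  fderiv ℝ g x (Pi.single i 1)

lemma pd_mul {d : ℕ} (i : Fin d) {g h : (Fin d → ℝ) → ℝ} {x : Fin d → ℝ}
    (hg : DifferentiableAt ℝ g x) (hh : DifferentiableAt ℝ h x) :
    pd i (fun y => g y * h y) x = pd i g x * h x + g x * pd i h x := by
  simp only [pd, fderiv_fun_mul hg hh, _root_.add_apply, _root_.smul_apply, smul_eq_mul]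
  ring

lemma pd_add {d : ℕ} (i : Fin d) {g h : (Fin d → ℝ) → ℝ} {x : Fin d → ℝ}
    (hg : DifferentiableAt ℝ g x) (hh : DifferentiableAt ℝ h x) :
    pd i (fun y => g y + h y) x = pd i g x + pd i h x := by
  simp only [pd, fderiv_fun_add hg hh, _root_.add_apply]

lemma pd_sum {d : ℕ} {ι : Type*} (s : Finset ι) (i : Fin d) {g : ι → (Fin d → ℝ) → ℝ}
    {x : Fin d → ℝ} (hg : ∀ j ∈ s, DifferentiableAt ℝ (g j) x) :
    pd i (fun y => ∑ j ∈ s, g j y) x = ∑ j ∈ s, pd i (g j) x := by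
  simp only [pd, fderiv_fun_sum hg, _root_.sum_apply]

lemma pd_inv {d : ℕ} (i : Fin d) {g : (Fin d → ℝ) → ℝ} {x : Fin d → ℝ}
    (hg : DifferentiableAt ℝ g x) (h0 : g x ≠ 0) :
    pd i (fun y => (g y)⁻¹) x = -pd i g x / g x ^ 2 := by
  have h := (hasDerivAt_inv h0).comp_hasFDerivAt x hg.hasFDerivAt
  have h' : fderiv ℝ (fun y => (g y)⁻¹) x = -(g x ^ 2)⁻¹ • fderiv ℝ g x := h.fderiv
  simp only [pd, h', _root_.smul_apply, smul_eq_mul]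
  ring

lemma ContDiff.pd {d : ℕ} (i : Fin d) {g : (Fin d → ℝ) → ℝ}
    (hg : ContDiff ℝ (⊤ : ℕ∞) g) : ContDiff ℝ (⊤ : ℕ∞) (pd i g) :=
  (hg.fderiv_right (m := (⊤ : ℕ∞)) (by simp)).clm_apply contDiff_const

lemma pd_pd_mul {d : ℕ} (i j : Fin d) {g h : (Fin d → ℝ) → ℝ}
    (hg : ContDiff ℝ (⊤ : ℕ∞) g) (hh : ContDiff ℝ (⊤ : ℕ∞) h) (x : Fin d → ℝ) :
    pd i (pd j (fun y => g y * h y)) x =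
      pd i (pd j g) x * h x + pd j g x * pd i h x + pd i g x * pd j h x
        + g x * pd i (pd j h) x := by
  have diff {k : (Fin d → ℝ) → ℝ} (hk : ContDiff ℝ (⊤ : ℕ∞) k) : Differentiable ℝ k :=
    hk.differentiable (by simp)
  have hj : pd j (fun y => g y * h y) = fun y => pd j g y * h y + g y * pd j h y :=
    funext fun y => pd_mul j (diff hg y) (diff hh y)
  rw [hj, pd_add i ((diff (hg.pd j) x).fun_mul (diff hh x))
      ((diff hg x).fun_mul (diff (hh.pd j) x)),
    pd_mul i (diff (hg.pd j) x) (diff hh x), pd_mul i (diff hg x) (diff (hh.pd j) x)]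
  ring

lemma ContDiff.matrix_det {E : Type*} [NormedAddCommGroup E] [NormedSpace ℝ E]
    {n : Type*} [Fintype n] [DecidableEq n] {k : WithTop ℕ∞} {A : E → Matrix n n ℝ}
    (hA : ∀ i j, ContDiff ℝ k (fun x => A x i j)) : ContDiff ℝ k (fun x => (A x).det) := by
  simp only [Matrix.det_apply']
  exact ContDiff.sum fun σ _ => contDiff_const.mul (contDiff_prod fun i _ => hA _ _)

/-- Euclidean-coordinate form of the lemma expressing `𝓛 + 𝓛*` as
`Δ_ĝ f + ∇_ĝ f · ∇_ĝ ρ / ρ` plus a zeroth-order term: subtracting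
`f·(𝓛1 + 𝓛*1)` from `𝓛f + 𝓛*f` leaves `Δ̂f + ρ⁻¹ ∑ Cᵢⱼ ∂ᵢf ∂ⱼρ`. -/
theorem generator_plus_adjoint_is_weighted_laplacian
    (d : ℕ) (hd : 1 ≤ d)
    (μ : (Fin d → ℝ) → (Fin d → ℝ)) (hμ : ContDiff ℝ (⊤ : ℕ∞) μ)
    (C : (Fin d → ℝ) → Matrix (Fin d) (Fin d) ℝ) (hCpos : ∀ x, (C x).PosDef)
    (hCsmooth : ∀ i j, ContDiff ℝ (⊤ : ℕ∞) (fun x => C x i j))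
    (f : (Fin d → ℝ) → ℝ) (hf : ContDiff ℝ (⊤ : ℕ∞) f)
    (ρ : (Fin d → ℝ) → ℝ) (hρ : ∀ x, ρ x = Real.sqrt (C x).det)
    (Δhat : ((Fin d → ℝ) → ℝ) → (Fin d → ℝ) → ℝ)
    (hΔhat : ∀ g x, Δhat g x = ρ x * ∑ i, pd i (fun y => (ρ y)⁻¹ * ∑ j, C y i j * pd j g y) x) :
    ∀ x : Fin d → ℝ,
      (((∑ i, μ x i * pd i f x) + (1 / 2) * ∑ i, ∑ j, C x i j * pd i (pd j f) x) +
        (-(∑ i, pd i (fun y => μ y i * f y) x) +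
          (1 / 2) * ∑ i, ∑ j, pd i (pd j (fun y => C y i j * f y)) x)) -
      f x * (-(∑ i, pd i (fun y => μ y i) x) +
          (1 / 2) * ∑ i, ∑ j, pd i (pd j (fun y => C y i j)) x)
      = Δhat f x + (ρ x)⁻¹ * ∑ i, ∑ j, C x i j * pd i f x * pd j ρ x := by
  intro x
  have diff {k : (Fin d → ℝ) → ℝ} (hk : ContDiff ℝ (⊤ : ℕ∞) k) : Differentiable ℝ k :=
    hk.differentiable (by simp)
  have hdet (y) : 0 < (C y).det := (hCpos y).det_pos
  have hρ0 : ρ x ≠ 0 := by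
    rw [hρ]
    exact (Real.sqrt_pos.2 (hdet x)).ne'
  have hρs : ContDiff ℝ (⊤ : ℕ∞) ρ := by
    rw [show ρ = fun y => Real.sqrt (C y).det from funext hρ]
    exact (ContDiff.matrix_det hCsmooth).sqrt fun y => (hdet y).ne'
  have hsymm (y) (i j : Fin d) : C y i j = C y j i := by
    simpa using (hCpos y).1.apply j i
  have hμs (i : Fin d) : ContDiff ℝ (⊤ : ℕ∞) (fun y => μ y i) := contDiff_pi.1 hμ i
  have hdrift : ∑ i, pd i (fun y => μ y i * f y) x =
      f x * ∑ i, pd i (fun y => μ y i) x + ∑ i, μ x i * pd i f x := by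
    rw [Finset.mul_sum, ← Finset.sum_add_distrib]
    refine Finset.sum_congr rfl fun i _ => ?_
    rw [pd_mul i (diff (hμs i) x) (diff hf x)]
    ring
  have hcross : ∑ i, ∑ j, pd j (fun y => C y i j) x * pd i f x =
      ∑ i, ∑ j, pd i (fun y => C y i j) x * pd j f x := by
    rw [Finset.sum_comm]
    refine Finset.sum_congr rfl fun i _ => Finset.sum_congr rfl fun j _ => ?_
    rw [show (fun y => C y j i) = fun y => C y i j from funext fun y => hsymm y j i]
  have hsecond : ∑ i, ∑ j, pd i (pd j (fun y => C y i j * f y)) x =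
      f x * ∑ i, ∑ j, pd i (pd j (fun y => C y i j)) x
        + 2 * ∑ i, ∑ j, pd i (fun y => C y i j) x * pd j f x
        + ∑ i, ∑ j, C x i j * pd i (pd j f) x := by
    rw [two_mul]
    nth_rewrite 1 [← hcross]
    simp only [Finset.mul_sum, ← Finset.sum_add_distrib]
    refine Finset.sum_congr rfl fun i _ => Finset.sum_congr rfl fun j _ => ?_
    rw [pd_pd_mul i j (hCsmooth i j) hf]
    ring
  have hweight : ∑ i, ∑ j, C x i j * pd i f x * pd j ρ x =
      ∑ i, ∑ j, C x i j * pd j f x * pd i ρ x := by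
    rw [Finset.sum_comm]
    refine Finset.sum_congr rfl fun i _ => Finset.sum_congr rfl fun j _ => ?_
    rw [hsymm x j i]
  have hlap : Δhat f x + (ρ x)⁻¹ * ∑ i, ∑ j, C x i j * pd i f x * pd j ρ x =
      ∑ i, ∑ j, pd i (fun y => C y i j) x * pd j f x
        + ∑ i, ∑ j, C x i j * pd i (pd j f) x := by
    rw [hΔhat, hweight]
    simp only [Finset.mul_sum, ← Finset.sum_add_distrib]
    refine Finset.sum_congr rfl fun i _ => ?_
    have hflux (j : Fin d) : DifferentiableAt ℝ (fun y => C y i j * pd j f y) x :=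
      (diff (hCsmooth i j) x).mul (diff (hf.pd j) x)
    have hexpand : pd i (fun y => ∑ j, (ρ y)⁻¹ * (C y i j * pd j f y)) x =
        ∑ j, (-pd i ρ x / ρ x ^ 2 * (C x i j * pd j f x) + (ρ x)⁻¹ *
          (pd i (fun y => C y i j) x * pd j f x + C x i j * pd i (pd j f) x)) := by
      rw [pd_sum _ _ fun j _ => ((diff hρs x).fun_inv hρ0).fun_mul (hflux j)]
      refine Finset.sum_congr rfl fun j _ => ?_
      rw [pd_mul i ((diff hρs x).fun_inv hρ0) (hflux j), pd_inv i (diff hρs x) hρ0,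
        pd_mul i (diff (hCsmooth i j) x) (diff (hf.pd j) x)]
    rw [hexpand, Finset.mul_sum, ← Finset.sum_add_distrib]
    refine Finset.sum_congr rfl fun j _ => ?_
    field_simp
    ring
  rw [hlap, hdrift, hsecond]
  ring
end

section
/- Let d ≥ 1, let A : ℝ^d → (symmetric positive-definite d×d real matrices) be smooth, with constants 0 < λ ≤ Λ such that λ‖v‖² ≤ vᵀA(y)v ≤ Λ‖v‖² for all y, v, and with all partial derivatives of the entries of A bounded. Let f : ℝ^d → ℝ be smooth with compact support. Define the symmetrized prototypical kernel K̄(ε,x,y) = exp(−(y−x)ᵀA(x)⁻¹(y−x)/(2ε)) + exp(−(y−x)ᵀA(y)⁻¹(y−x)/(2ε)), and q(x) = (det A(x))^{1/2}. Then for every x ∈ ℝ^d: lim_{ε→0⁺} (1/ε)·( ( ∫_{ℝ^d} K̄(ε,x,y) f(y) dy ) / ( ∫_{ℝ^d} K̄(ε,x,y) dy ) − f(x) ) = (1/(2·q(x)))·∑_{i,j} ∂_i( q·A_{ij}·∂_j f )(x). (Euclidean case of the theorem on the expansion of symmetric local kernels: the left-normalized symmetrized kernel converges to a divergence-form elliptic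 operator, the weighted Laplacian of the metric determined by the kernel's second moment.) -/
open MeasureTheory Matrix

open Filter Topology

theorem one_add_pow_mul_exp_neg_sq_le {c : ℝ} (hc : 0 < c) (n : ℕ) :
    ∃ C : ℝ, 0 ≤ C ∧ ∀ t : ℝ, 0 ≤ t → (1 + t) ^ n * Real.exp (-(c * t ^ 2)) ≤ C := by
  refine ⟨n.factorial * Real.exp (1 + 1 / c), by positivity, fun t ht => ?_⟩
  have h2 := Real.pow_div_factorial_le_exp (1 + t) (by positivity) n
  rw [div_le_iff₀ (by positivity)] at h2
  calc (1 + t) ^ n * Real.exp (-(c * t ^ 2))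
      ≤ (Real.exp (1 + t) * n.factorial) * Real.exp (-(c * t ^ 2)) := by gcongr
    _ = n.factorial * Real.exp (1 + t - c * t ^ 2) := by
        rw [mul_comm (Real.exp _), mul_assoc, ← Real.exp_add]; ring_nf
    _ ≤ _ := by
        gcongr
        have h : c * (t - 1 / c) ^ 2 = c * t ^ 2 - 2 * t + 1 / c := by field_simp; ring
        have hc' : 0 < 1 / c := by positivity
        nlinarith [mul_nonneg hc.le (sq_nonneg t), mul_nonneg hc.le (sq_nonneg (t - 1 / c))]

/-- Polynomials times Gaussians are integrable. -/
theorem integrable_one_add_norm_pow_mul_exp_neg_sq {E : Type*} [NormedAddCommGroup E]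
    [NormedSpace ℝ E] [FiniteDimensional ℝ E] [MeasurableSpace E] [BorelSpace E]
    (μ : Measure E) [μ.IsAddHaarMeasure] {c : ℝ} (hc : 0 < c) (n : ℕ) :
    Integrable (fun z : E => (1 + ‖z‖) ^ n * Real.exp (-(c * ‖z‖ ^ 2))) μ := by
  obtain ⟨C, -, hC⟩ := one_add_pow_mul_exp_neg_sq_le hc (n + (Module.finrank ℝ E + 1))
  have hi := (integrable_one_add_norm (μ := μ) (E := E)
    (r := (Module.finrank ℝ E + 1 : ℕ)) (by push_cast; linarith)).const_mul C
  refine hi.mono' (by fun_prop) (Eventually.of_forall fun z => ?_)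
  have h1 : 0 < 1 + ‖z‖ := by positivity
  rw [Real.norm_of_nonneg (by positivity), Real.rpow_neg h1.le, Real.rpow_natCast,
    ← div_eq_mul_inv, le_div_iff₀ (by positivity)]
  have := hC ‖z‖ (norm_nonneg z)
  rw [pow_add] at this
  linarith

theorem integrable_of_abs_le_poly_mul_gaussian {E : Type*} [NormedAddCommGroup E]
    [NormedSpace ℝ E] [FiniteDimensional ℝ E] [MeasurableSpace E] [BorelSpace E]
    (μ : Measure E) [μ.IsAddHaarMeasure] {c : ℝ} (hc : 0 < c) {K : ℝ} {n : ℕ} {g φ : E → ℝ}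
    (hg : Continuous g) (hφ : Continuous φ) (hgc : ∀ z, |g z| ≤ Real.exp (-(c * ‖z‖ ^ 2)))
    (hK : ∀ z, |φ z| ≤ K * (1 + ‖z‖) ^ n) :
    Integrable (fun z => g z * φ z) μ := by
  refine ((integrable_one_add_norm_pow_mul_exp_neg_sq μ hc n).const_mul K).mono'
    (by fun_prop) (Eventually.of_forall fun z => ?_)
  rw [Real.norm_eq_abs, abs_mul, mul_comm]
  calc |φ z| * |g z| ≤ (K * (1 + ‖z‖) ^ n) * Real.exp (-(c * ‖z‖ ^ 2)) :=
        mul_le_mul (hK z) (hgc z) (abs_nonneg _) ((abs_nonneg _).trans (hK z))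
    _ = _ := by ring

/-- The unnormalised Gaussian weight with precision matrix `P`. -/
noncomputable def gaussWeight {d : ℕ} (P : Matrix (Fin d) (Fin d) ℝ) (z : Fin d → ℝ) : ℝ :=
  Real.exp (-(z ⬝ᵥ (P *ᵥ z)) / 2)

section GaussWeight

variable {d : ℕ} {P : Matrix (Fin d) (Fin d) ℝ}

theorem continuous_gaussWeight : Continuous (gaussWeight P) := by
  unfold gaussWeight
  fun_prop

theorem abs_gaussWeight_le {c : ℝ} (hP : ∀ z, c * ‖z‖ ^ 2 ≤ z ⬝ᵥ (P *ᵥ z)) (z : Fin d → ℝ) :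
    |gaussWeight P z| ≤ Real.exp (-(c / 2 * ‖z‖ ^ 2)) := by
  rw [gaussWeight, Real.abs_exp]
  gcongr
  linarith [hP z]

theorem fderiv_gaussWeight_single (hsymm : P.IsSymm) (z : Fin d → ℝ) (l : Fin d) :
    DifferentiableAt ℝ (gaussWeight P) z ∧
    fderiv ℝ (gaussWeight P) z (Pi.single l 1) = -(gaussWeight P z * (P *ᵥ z) l) := by
  have h0 : HasFDerivAt (fun z : Fin d → ℝ => z ⬝ᵥ (P *ᵥ z))
      (∑ a, ∑ b, P a b • (z a • ContinuousLinearMap.proj (R := ℝ) (φ := fun _ : Fin d => ℝ) b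
        + z b • ContinuousLinearMap.proj a)) z := by
    have : (fun z : Fin d → ℝ => z ⬝ᵥ (P *ᵥ z)) = fun z => ∑ a, ∑ b, P a b * (z a * z b) := by
      ext z
      simp only [dotProduct, mulVec, Finset.mul_sum]
      exact Finset.sum_congr rfl fun a _ => Finset.sum_congr rfl fun b _ => by ring
    rw [this]
    refine HasFDerivAt.fun_sum fun a _ => HasFDerivAt.fun_sum fun b _ => HasFDerivAt.const_mul ?_ _
    exact (hasFDerivAt_apply a z).mul (hasFDerivAt_apply b z)
  have h1 := ((h0.const_mul (-1 / 2)).exp)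
  have h2 : gaussWeight P = fun z => Real.exp (-1 / 2 * (z ⬝ᵥ (P *ᵥ z))) := by
    ext z; rw [gaussWeight]; ring_nf
  rw [h2]
  refine ⟨h1.differentiableAt, ?_⟩
  rw [h1.fderiv]
  simp only [FunLike.coe_smul, Pi.smul_apply, FunLike.coe_sum, Finset.sum_apply, FunLike.coe_add,
    Pi.add_apply, smul_eq_mul, ContinuousLinearMap.proj_apply, Pi.single_apply, mulVec, dotProduct]
  have h3 : ∑ a, ∑ b, P a b * ((z a * if b = l then 1 else 0) + z b * if a = l then 1 else 0)
      = 2 * ∑ b, P l b * z b := by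
    simp only [mul_add, Finset.sum_add_distrib, mul_ite, mul_one, mul_zero]
    rw [Finset.sum_comm (f := fun a b => if a = l then P a b * z b else 0)]
    simp only [Finset.sum_ite_eq', Finset.mem_univ, if_true, two_mul]
    congr 1
    exact Finset.sum_congr rfl fun a _ => by rw [hsymm.apply]
  rw [h3]
  ring

/-- Gaussian integration by parts (Stein's identity). -/
theorem integral_gaussWeight_mul_coord_mul {B : Matrix (Fin d) (Fin d) ℝ} (hsymm : P.IsSymm)
    (hBP : B * P = 1) {c : ℝ} (hc : 0 < c) (hP : ∀ z, c * ‖z‖ ^ 2 ≤ z ⬝ᵥ (P *ᵥ z))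
    {φ : (Fin d → ℝ) → ℝ} (hφ : ContDiff ℝ 1 φ) {K : ℝ} {n : ℕ}
    (hK : ∀ z, |φ z| ≤ K * (1 + ‖z‖) ^ n)
    (hK' : ∀ l z, |pd l φ z| ≤ K * (1 + ‖z‖) ^ n) (k : Fin d) :
    ∫ z, gaussWeight P z * (z k * φ z) = ∑ l, B k l * ∫ z, gaussWeight P z * pd l φ z := by
  have hc2 : 0 < c / 2 := by linarith
  have hg := abs_gaussWeight_le hP
  have hcoord : ∀ k, Integrable (fun z => gaussWeight P z * (z k * φ z)) := fun k => by
    refine integrable_of_abs_le_poly_mul_gaussian (n := n + 1) (K := K) volume hc2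
      continuous_gaussWeight ((continuous_apply k).mul hφ.continuous) hg fun z => ?_
    rw [abs_mul, mul_comm, pow_succ, ← mul_assoc]
    have := norm_le_pi_norm z k
    rw [Real.norm_eq_abs] at this
    exact mul_le_mul (hK z) (by linarith) (abs_nonneg _) ((abs_nonneg _).trans (hK z))
  have hpd : ∀ l, Continuous (pd l φ) := fun l =>
    (hφ.continuous_fderiv (by norm_num)).clm_apply continuous_const
  have hPl : ∀ l z, gaussWeight P z * (P *ᵥ z) l * φ z
      = ∑ b, P l b * (gaussWeight P z * (z b * φ z)) := fun l z => by
    simp only [mulVec, dotProduct, Finset.mul_sum, Finset.sum_mul]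
    exact Finset.sum_congr rfl fun b _ => by ring
  have key : ∀ l, ∫ z, gaussWeight P z * pd l φ z
      = ∑ b, P l b * ∫ z, gaussWeight P z * (z b * φ z) := fun l => by
    have := integral_mul_fderiv_eq_neg_fderiv_mul_of_integrable (μ := volume)
      (f := gaussWeight P) (g := φ) (v := Pi.single l (1 : ℝ)) ?_ ?_ ?_
      (fun z _ => (fderiv_gaussWeight_single hsymm z l).1)
      (fun z _ => hφ.differentiable (by norm_num) z)
    · refine this.trans ?_
      rw [← integral_neg]
      simp_rw [(fderiv_gaussWeight_single hsymm _ l).2, neg_mul, neg_neg, hPl]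
      rw [integral_finsetSum _ fun b _ => (hcoord b).const_mul _]
      simp_rw [integral_const_mul]
    · simp_rw [(fderiv_gaussWeight_single hsymm _ l).2, neg_mul, hPl]
      exact (integrable_finsetSum _ fun b _ => (hcoord b).const_mul _).neg
    · exact integrable_of_abs_le_poly_mul_gaussian volume hc2
        continuous_gaussWeight (hpd l) hg (hK' l)
    · exact integrable_of_abs_le_poly_mul_gaussian volume hc2
        continuous_gaussWeight hφ.continuous hg hK
  simp_rw [key, Finset.mul_sum]
  rw [Finset.sum_comm]
  simp_rw [← mul_assoc, ← Finset.sum_mul, ← Matrix.mul_apply, hBP, Matrix.one_apply]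
  simp

theorem abs_apply_le_one_add_norm (z : Fin d → ℝ) (k : Fin d) : |z k| ≤ 1 + ‖z‖ := by
  have := norm_le_pi_norm z k
  rw [Real.norm_eq_abs] at this
  linarith

theorem integral_gaussWeight_mul_coord_mul_coord {B : Matrix (Fin d) (Fin d) ℝ}
    (hsymm : P.IsSymm) (hBP : B * P = 1) {c : ℝ} (hc : 0 < c)
    (hP : ∀ z, c * ‖z‖ ^ 2 ≤ z ⬝ᵥ (P *ᵥ z)) (k a : Fin d) :
    ∫ z, gaussWeight P z * (z k * z a) = B k a * ∫ z, gaussWeight P z := by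
  have hpd : ∀ l (z : Fin d → ℝ), pd l (fun z => z a) z = if a = l then 1 else 0 := fun l z => by
    rw [pd, (hasFDerivAt_apply a z).fderiv]
    simp [Pi.single_apply]
  rw [integral_gaussWeight_mul_coord_mul hsymm hBP hc hP (φ := fun z => z a) (K := 1) (n := 1)
    (contDiff_apply ℝ ℝ a) (fun z => by simpa using abs_apply_le_one_add_norm z a)
    (fun l z => ?_)]
  · simp_rw [hpd, integral_mul_const]
    simp [mul_comm]
  · rw [hpd]
    have := norm_nonneg z
    split_ifs
    · simp
    · simpa using by linarith

/-- Isserlis' formula for the fourth moments. -/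
theorem integral_gaussWeight_mul_four_coord {B : Matrix (Fin d) (Fin d) ℝ}
    (hsymm : P.IsSymm) (hBP : B * P = 1) {c : ℝ} (hc : 0 < c)
    (hP : ∀ z, c * ‖z‖ ^ 2 ≤ z ⬝ᵥ (P *ᵥ z)) (k a b e : Fin d) :
    ∫ z, gaussWeight P z * (z k * (z a * z b * z e)) =
      (B k a * B b e + B k b * B a e + B k e * B a b) * ∫ z, gaussWeight P z := by
  have hpd : ∀ l (z : Fin d → ℝ), pd l (fun z => z a * z b * z e) z =
      (if a = l then z b * z e else 0) + (if b = l then z a * z e else 0) +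
        (if e = l then z a * z b else 0) := fun l z => by
    have h := ((hasFDerivAt_apply (𝕜 := ℝ) a z).fun_mul (hasFDerivAt_apply b z)).fun_mul
      (hasFDerivAt_apply e z)
    rw [pd, h.fderiv]
    simp [Pi.single_apply]
    split_ifs <;> ring
  have hb := abs_apply_le_one_add_norm (d := d)
  have h2 : ∀ (z : Fin d → ℝ) i j, |z i * z j| ≤ (1 + ‖z‖) ^ 2 := fun z i j => by
    rw [abs_mul, sq]
    have := hb z
    gcongr <;> apply this
  have hInt : ∀ i j, Integrable (fun z : Fin d → ℝ => gaussWeight P z * (z i * z j)) :=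
    fun i j => integrable_of_abs_le_poly_mul_gaussian (n := 2) (K := 1) volume (half_pos hc)
      continuous_gaussWeight (by fun_prop) (abs_gaussWeight_le hP) (by simpa using h2 · i j)
  rw [integral_gaussWeight_mul_coord_mul hsymm hBP hc hP (φ := fun z => z a * z b * z e)
    (K := 3) (n := 3) (by fun_prop) (fun z => ?_) (fun l z => ?_)]
  · have : ∀ l, ∫ z, gaussWeight P z * pd l (fun z => z a * z b * z e) z =
        (if a = l then B b e else 0) * (∫ z, gaussWeight P z) +
        (if b = l then B a e else 0) * (∫ z, gaussWeight P z) +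
        (if e = l then B a b else 0) * (∫ z, gaussWeight P z) := fun l => by
      have hite : ∀ (p : Prop) [Decidable p] i j,
          Integrable (fun z : Fin d → ℝ => gaussWeight P z * if p then z i * z j else 0) := by
        intro p _ i j
        split_ifs
        · exact hInt i j
        · simp
      have hval : ∀ (p : Prop) [Decidable p] i j,
          ∫ z : Fin d → ℝ, gaussWeight P z * (if p then z i * z j else 0) =
            (if p then B i j else 0) * ∫ z, gaussWeight P z := by
        intro p _ i j
        split_ifs
        · exact integral_gaussWeight_mul_coord_mul_coord hsymm hBP hc hP i j
        · simp
      simp_rw [hpd, mul_add]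
      rw [integral_add ((hite _ _ _).fun_add (hite _ _ _)) (hite _ _ _),
        integral_add (hite _ _ _) (hite _ _ _), hval, hval, hval]
    simp_rw [this, mul_add, Finset.sum_add_distrib, ← mul_assoc, ← Finset.sum_mul]
    simp [add_mul]
  · rw [abs_mul, pow_succ]
    have := mul_le_mul (h2 z a b) (hb z e) (abs_nonneg _) (by positivity)
    have h0 : 0 ≤ (1 + ‖z‖) ^ 2 * (1 + ‖z‖) := by positivity
    linarith
  · rw [hpd]
    have h0 : (0 : ℝ) ≤ ‖z‖ := norm_nonneg z
    have hle : (1 + ‖z‖) ^ 2 ≤ (1 + ‖z‖) ^ 3 := pow_le_pow_right₀ (by linarith) (by norm_num)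
    have hite : ∀ (p : Prop) [Decidable p] i j,
        |if p then z i * z j else 0| ≤ (1 + ‖z‖) ^ 3 := by
      intro p _ i j
      split_ifs
      · exact (h2 z i j).trans hle
      · simp; positivity
    refine (abs_add_three _ _ _).trans ?_
    linarith [hite (a = l) b e, hite (b = l) a e, hite (e = l) a b]

end GaussWeight

section MatrixCalculus

variable {d : ℕ} {E : Type*} [NormedAddCommGroup E] [NormedSpace ℝ E]

theorem contDiff_matrix_det {n : WithTop ℕ∞} {M : E → Matrix (Fin d) (Fin d) ℝ}
    (hM : ∀ i j, ContDiff ℝ n fun y => M y i j) : ContDiff ℝ n fun y => (M y).det := by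
  simp_rw [Matrix.det_apply]
  exact ContDiff.sum fun σ _ => (contDiff_prod fun i _ => hM _ _).const_smul _

theorem contDiff_matrix_inv {n : WithTop ℕ∞} {M : E → Matrix (Fin d) (Fin d) ℝ}
    (hM : ∀ i j, ContDiff ℝ n fun y => M y i j) (h0 : ∀ y, (M y).det ≠ 0) (i j : Fin d) :
    ContDiff ℝ n fun y => (M y)⁻¹ i j := by
  simp_rw [Matrix.inv_def, Matrix.smul_apply, Ring.inverse_eq_inv', Matrix.adjugate_apply,
    smul_eq_mul]
  refine ((contDiff_matrix_det hM).inv h0).mul (contDiff_matrix_det fun k l => ?_)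
  by_cases h : k = j
  · subst h
    simpa using contDiff_const
  · simpa [Matrix.updateRow_apply, h] using hM k l

/-- The entrywise directional derivative of a matrix field. -/
noncomputable def matrixDeriv (M : E → Matrix (Fin d) (Fin d) ℝ) (x v : E) :
    Matrix (Fin d) (Fin d) ℝ :=
  Matrix.of fun i j => fderiv ℝ (fun y => M y i j) x v

theorem matrixDeriv_inv {M : E → Matrix (Fin d) (Fin d) ℝ}
    (hM : ∀ i j, ContDiff ℝ 1 fun y => M y i j) (h0 : ∀ y, (M y).det ≠ 0) (x v : E) :
    matrixDeriv (fun y => (M y)⁻¹) x v = -((M x)⁻¹ * matrixDeriv M x v * (M x)⁻¹) := by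
  have hu : IsUnit (M x).det := (h0 x).isUnit
  have hprod : matrixDeriv M x v * (M x)⁻¹ + M x * matrixDeriv (fun y => (M y)⁻¹) x v = 0 := by
    ext i j
    have h1 : HasFDerivAt (fun y => ∑ k, M y i k * (M y)⁻¹ k j)
        (∑ k, (M x i k • fderiv ℝ (fun y => (M y)⁻¹ k j) x
          + (M x)⁻¹ k j • fderiv ℝ (fun y => M y i k) x)) x :=
      HasFDerivAt.fun_sum fun k _ =>
        ((hM i k).differentiable (by norm_num) x).hasFDerivAt.fun_mul
          ((contDiff_matrix_inv hM h0 k j).differentiable (by norm_num) x).hasFDerivAt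
    have h2 : (fun y => ∑ k, M y i k * (M y)⁻¹ k j) =
        fun _ => (1 : Matrix (Fin d) (Fin d) ℝ) i j := by
      ext y
      rw [← Matrix.mul_apply, Matrix.mul_nonsing_inv _ (h0 y).isUnit]
    rw [h2] at h1
    have h3 := congrArg (fun L : E →L[ℝ] ℝ => L v) (h1.unique (hasFDerivAt_const _ _))
    simp only [FunLike.coe_sum, FunLike.coe_add, FunLike.coe_smul, Finset.sum_apply, Pi.add_apply,
      Pi.smul_apply, smul_eq_mul, Finset.sum_add_distrib, FunLike.coe_zero, Pi.zero_apply] at h3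
    simp only [Matrix.add_apply, Matrix.mul_apply, matrixDeriv, Matrix.of_apply, Matrix.zero_apply]
    rw [← h3, add_comm]
    congr 1
    exact Finset.sum_congr rfl fun k _ => mul_comm _ _
  have h := congrArg (fun N => (M x)⁻¹ * N) hprod
  simp only [mul_add, ← mul_assoc, Matrix.nonsing_inv_mul _ hu, one_mul, mul_zero] at h
  rw [add_comm] at h
  exact eq_neg_of_add_eq_zero_left h

theorem fderiv_det_of_eq_one {M : E → Matrix (Fin d) (Fin d) ℝ} {x : E}
    (hM : ∀ i j, DifferentiableAt ℝ (fun y => M y i j) x) (h1 : M x = 1) (v : E) :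
    fderiv ℝ (fun y => (M y).det) x v = (matrixDeriv M x v).trace := by
  have h : HasFDerivAt (fun y => ∑ σ : Equiv.Perm (Fin d),
      ((Equiv.Perm.sign σ : ℤ) : ℝ) * ∏ i, M y (σ i) i)
      (∑ σ : Equiv.Perm (Fin d), ((Equiv.Perm.sign σ : ℤ) : ℝ) •
        ∑ i, (∏ j ∈ Finset.univ.erase i, M x (σ j) j) • fderiv ℝ (fun y => M y (σ i) i) x) x :=
    HasFDerivAt.fun_sum fun σ _ => HasFDerivAt.const_mul
      (HasFDerivAt.finsetProd fun i _ => (hM (σ i) i).hasFDerivAt) _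
  simp_rw [Matrix.det_apply']
  rw [h.fderiv, h1]
  simp only [FunLike.coe_sum, FunLike.coe_smul, Finset.sum_apply,
    Pi.smul_apply, smul_eq_mul, Matrix.trace, Matrix.diag, matrixDeriv, Matrix.of_apply]
  rw [Finset.sum_eq_single 1]
  · simp only [Equiv.Perm.sign_one, Units.val_one, Int.cast_one, one_mul]
    refine Finset.sum_congr rfl fun i _ => ?_
    have : ∏ j ∈ Finset.univ.erase i,
        (1 : Matrix (Fin d) (Fin d) ℝ) ((1 : Equiv.Perm (Fin d)) j) j = 1 :=
      Finset.prod_eq_one fun j _ => Matrix.one_apply_eq j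
    rw [this, one_mul, Equiv.Perm.one_apply]
  · intro σ _ hσ
    rw [Finset.sum_eq_zero, mul_zero]
    intro i _
    have : ∃ j ∈ Finset.univ.erase i, σ j ≠ j := by
      by_contra! hcon
      have hi : ∀ j, j ≠ i → σ j = j := fun j hj => hcon j (by simp [hj])
      refine hσ (Equiv.ext fun j => ?_)
      by_cases hj : j = i
      · subst hj
        by_contra hne
        exact hne (σ.injective (hi _ hne))
      · exact hi j hj
    obtain ⟨j, hj, hne⟩ := this
    rw [Finset.prod_eq_zero (f := fun j => (1 : Matrix (Fin d) (Fin d) ℝ) (σ j) j) hj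
      (Matrix.one_apply_ne hne), zero_mul]
  · simp

/-- Jacobi's formula for the derivative of a determinant. -/
theorem fderiv_det {M : E → Matrix (Fin d) (Fin d) ℝ} {x : E}
    (hM : ∀ i j, DifferentiableAt ℝ (fun y => M y i j) x) (h0 : (M x).det ≠ 0) (v : E) :
    fderiv ℝ (fun y => (M y).det) x v = (M x).det * ((M x)⁻¹ * matrixDeriv M x v).trace := by
  have hu : IsUnit (M x).det := h0.isUnit
  have hentry : ∀ i j, HasFDerivAt (fun y => ((M x)⁻¹ * M y) i j)
      (∑ k, (M x)⁻¹ i k • fderiv ℝ (fun y => M y k j) x) x := fun i j => by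
    simp_rw [Matrix.mul_apply]
    exact HasFDerivAt.fun_sum fun k _ => (hM k j).hasFDerivAt.const_mul _
  have h1 := fderiv_det_of_eq_one (M := fun y => (M x)⁻¹ * M y)
    (fun i j => (hentry i j).differentiableAt) (Matrix.nonsing_inv_mul _ hu) v
  have h2 : matrixDeriv (fun y => (M x)⁻¹ * M y) x v = (M x)⁻¹ * matrixDeriv M x v := by
    ext i j
    rw [matrixDeriv, Matrix.of_apply, (hentry i j).fderiv, Matrix.mul_apply]
    simp [matrixDeriv]
  rw [h2] at h1
  rw [← h1]
  have hd : DifferentiableAt ℝ (fun y => (M y).det) x := by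
    simp_rw [Matrix.det_apply']
    fun_prop
  simp_rw [Matrix.det_mul]
  rw [fderiv_const_mul hd, Matrix.det_nonsing_inv, Ring.inverse_eq_inv']
  simp [h0]

end MatrixCalculus

section EllipticBounds

variable {d : ℕ} {A : Matrix (Fin d) (Fin d) ℝ}

theorem sq_norm_le_sum_sq (v : Fin d → ℝ) : ‖v‖ ^ 2 ≤ ∑ i, v i ^ 2 := by
  have h : ‖v‖ ≤ √(∑ i, v i ^ 2) := by
    refine (pi_norm_le_iff_of_nonneg (Real.sqrt_nonneg _)).2 fun i => ?_
    rw [Real.norm_eq_abs, ← Real.sqrt_sq_eq_abs]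
    exact Real.sqrt_le_sqrt (Finset.single_le_sum (f := fun i => v i ^ 2)
      (fun j _ => sq_nonneg _) (Finset.mem_univ i))
  calc ‖v‖ ^ 2 ≤ √(∑ i, v i ^ 2) ^ 2 := by gcongr
    _ = _ := Real.sq_sqrt (Finset.sum_nonneg fun i _ => sq_nonneg _)

theorem inv_quadForm_lower_bound (hA : A.PosDef) {Λ : ℝ} (hΛ : 0 < Λ)
    (hb : ∀ v : Fin d → ℝ, v ⬝ᵥ (A *ᵥ v) ≤ Λ * ∑ i, v i ^ 2) (v : Fin d → ℝ) :
    Λ⁻¹ * ‖v‖ ^ 2 ≤ v ⬝ᵥ (A⁻¹ *ᵥ v) := by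
  have hu : IsUnit A.det := hA.det_pos.ne'.isUnit
  have hsymm : Aᵀ = A := by simpa using hA.isHermitian.eq
  set w := A⁻¹ *ᵥ v
  have hAw : A *ᵥ w = v := by simp [w, Matrix.mul_nonsing_inv _ hu]
  have hvv : v ⬝ᵥ v = ∑ i, v i ^ 2 := by simp [dotProduct, sq]
  have hwAv : w ⬝ᵥ (A *ᵥ v) = v ⬝ᵥ v := by
    rw [Matrix.dotProduct_mulVec, ← Matrix.mulVec_transpose, hsymm, hAw]
  have hpos : 0 ≤ (w - Λ⁻¹ • v) ⬝ᵥ (A *ᵥ (w - Λ⁻¹ • v)) := by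
    simpa using hA.posSemidef.dotProduct_mulVec_nonneg (w - Λ⁻¹ • v)
  rw [Matrix.mulVec_sub, Matrix.mulVec_smul, hAw, sub_dotProduct, dotProduct_sub, dotProduct_sub,
    dotProduct_smul, smul_dotProduct, smul_dotProduct, dotProduct_smul, hwAv,
    dotProduct_comm w v] at hpos
  simp only [smul_eq_mul] at hpos
  have h1 : Λ⁻¹ * (Λ⁻¹ * (v ⬝ᵥ A *ᵥ v)) ≤ Λ⁻¹ * (v ⬝ᵥ v) := by
    have : Λ⁻¹ * (v ⬝ᵥ A *ᵥ v) ≤ v ⬝ᵥ v := by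
      rw [inv_mul_le_iff₀ hΛ, hvv]
      exact hb v
    gcongr
  have h2 : Λ⁻¹ * ‖v‖ ^ 2 ≤ Λ⁻¹ * (v ⬝ᵥ v) := by
    rw [hvv]
    have := sq_norm_le_sum_sq v
    gcongr
  linarith

theorem abs_inv_apply_le (hA : A.PosDef) {lam : ℝ} (hlam : 0 < lam)
    (hb : ∀ v : Fin d → ℝ, lam * ∑ i, v i ^ 2 ≤ v ⬝ᵥ (A *ᵥ v)) (i j : Fin d) :
    |A⁻¹ i j| ≤ lam⁻¹ := by
  have hu : IsUnit A.det := hA.det_pos.ne'.isUnit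
  have h := hb (A⁻¹ *ᵥ Pi.single j 1)
  have hAw : A *ᵥ (A⁻¹ *ᵥ Pi.single j 1) = Pi.single j 1 := by
    rw [Matrix.mulVec_mulVec, Matrix.mul_nonsing_inv _ hu, Matrix.one_mulVec]
  rw [hAw] at h
  simp only [Matrix.mulVec_single_one, dotProduct_single, mul_one, Matrix.col_apply] at h
  have hj := Finset.single_le_sum (f := fun k => A⁻¹ k j ^ 2)
    (fun k _ => sq_nonneg _) (Finset.mem_univ j)
  have hi := Finset.single_le_sum (f := fun k => A⁻¹ k j ^ 2)
    (fun k _ => sq_nonneg _) (Finset.mem_univ i)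
  beta_reduce at hi hj
  set S := ∑ k, A⁻¹ k j ^ 2
  have h1 : lam * A⁻¹ i j ^ 2 ≤ A⁻¹ j j := (mul_le_mul_of_nonneg_left hi hlam.le).trans h
  have h2 : lam * A⁻¹ j j ^ 2 ≤ A⁻¹ j j := (mul_le_mul_of_nonneg_left hj hlam.le).trans h
  have h3 : A⁻¹ j j ≤ lam⁻¹ := by
    rw [← one_div lam, le_div_iff₀ hlam]
    by_contra! hcon
    nlinarith [sq_nonneg (A⁻¹ j j)]
  refine abs_le_of_sq_le_sq ?_ (by positivity)
  have h4 : A⁻¹ i j ^ 2 ≤ lam⁻¹ * A⁻¹ j j := by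
    rw [← div_eq_inv_mul, le_div_iff₀ hlam]; linarith
  have h5 : lam⁻¹ * A⁻¹ j j ≤ lam⁻¹ * lam⁻¹ := by gcongr
  rw [sq lam⁻¹]
  linarith

end EllipticBounds

section Taylor

variable {E : Type*} [NormedAddCommGroup E] [NormedSpace ℝ E]

theorem exists_abs_taylor_one_remainder_le {f : E → ℝ} (hf : ContDiff ℝ 2 f)
    (hfc : HasCompactSupport f) :
    ∃ K : ℝ, 0 ≤ K ∧ ∀ x v, |f (x + v) - f x - fderiv ℝ f x v| ≤ K * ‖v‖ ^ 2 := by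
  obtain ⟨K, hK⟩ := ContDiff.lipschitzWith_of_hasCompactSupport (hfc.fderiv ℝ)
    (hf.fderiv_right (m := 1) (by norm_num)) (by norm_num)
  refine ⟨K, K.2, fun x v => ?_⟩
  have h := (convex_closedBall x ‖v‖).norm_image_sub_le_of_norm_fderiv_le' (𝕜 := ℝ) (f := f)
    (φ := fderiv ℝ f x) (C := K * ‖v‖) (x := x) (y := x + v)
    (fun y _ => hf.differentiable (by norm_num) y) (fun y hy => ?_)
    (by simp) (by simp)
  · rw [add_sub_cancel_left, Real.norm_eq_abs] at h
    linarith
  · refine (hK.norm_sub_le y x).trans ?_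
    rw [mem_closedBall_iff_norm] at hy
    gcongr

theorem hasDerivAt_comp_add_smul {F : Type*} [NormedAddCommGroup F] [NormedSpace ℝ F] {f : E → F}
    (hf : Differentiable ℝ f) (x v : E) (s : ℝ) :
    HasDerivAt (fun s : ℝ => f (x + s • v)) (fderiv ℝ f (x + s • v) v) s := by
  have h1 : HasDerivAt (fun s : ℝ => x + s • v) v s := by
    simpa using ((hasDerivAt_id s).smul_const v).const_add x
  exact (hf (x + s • v)).hasFDerivAt.comp_hasDerivAt s h1

theorem tendsto_taylor_two {f : E → ℝ} (hf : ContDiff ℝ 2 f) (x v : E) :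
    Tendsto (fun s : ℝ => (f (x + s • v) - f x - s * fderiv ℝ f x v) / s ^ 2) (𝓝[>] 0)
      (𝓝 (fderiv ℝ (fderiv ℝ f) x v v / 2)) := by
  have hd1 := hasDerivAt_comp_add_smul (hf.differentiable (by norm_num)) x v
  have hd2 : HasDerivAt (fun s : ℝ => fderiv ℝ f (x + s • v) v)
      (fderiv ℝ (fderiv ℝ f) x v v) 0 := by
    have h := hasDerivAt_comp_add_smul
      ((hf.fderiv_right (m := 1) (by norm_num)).differentiable (by norm_num)) x v 0
    simpa using h.clm_apply (hasDerivAt_const 0 v)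
  refine HasDerivAt.lhopital_zero_nhdsGT
    (f' := fun s => fderiv ℝ f (x + s • v) v - fderiv ℝ f x v) (g' := fun s => 2 * s)
    (Eventually.of_forall fun s => ?_) (Eventually.of_forall fun s => ?_) ?_ ?_ ?_ ?_
  · simpa using ((hd1 s).sub_const (f x)).fun_sub ((hasDerivAt_id s).mul_const (fderiv ℝ f x v))
  · simpa using hasDerivAt_pow 2 s
  · filter_upwards [self_mem_nhdsWithin] with s hs
    have : (0 : ℝ) < s := hs
    positivity
  · have hcont : Continuous fun s : ℝ => f (x + s • v) - f x - s * fderiv ℝ f x v := by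
      have := hf.continuous
      fun_prop
    simpa using (hcont.tendsto 0).mono_left nhdsWithin_le_nhds
  · simpa using ((continuous_pow 2).tendsto (0 : ℝ)).mono_left nhdsWithin_le_nhds
  · have h := (hasDerivAt_iff_tendsto_slope_zero.1 hd2).mono_left
      (nhdsWithin_mono 0 fun s (hs : 0 < s) => hs.ne')
    refine (h.div_const 2).congr fun s => ?_
    simp only [zero_add, zero_smul, add_zero, smul_eq_mul]
    rw [div_eq_mul_inv, div_eq_mul_inv, mul_inv]
    ring

end Taylor

section LocalKernel

variable {d : ℕ} {P : (Fin d → ℝ) → Matrix (Fin d) (Fin d) ℝ}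

theorem quadForm_eq_sum (M : Matrix (Fin d) (Fin d) ℝ) (z : Fin d → ℝ) :
    z ⬝ᵥ (M *ᵥ z) = ∑ a, ∑ b, M a b * (z a * z b) := by
  simp only [dotProduct, mulVec, Finset.mul_sum]
  exact Finset.sum_congr rfl fun a _ => Finset.sum_congr rfl fun b _ => by ring

theorem continuous_gaussWeight_comp (hP : ∀ i j, ContDiff ℝ 1 fun y => P y i j)
    (x : Fin d → ℝ) (s : ℝ) : Continuous fun z => gaussWeight (P (x + s • z)) z := by
  have h : ∀ i j, Continuous fun z => P (x + s • z) i j := fun i j =>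
    (hP i j).continuous.comp (by fun_prop)
  unfold gaussWeight
  simp_rw [quadForm_eq_sum]
  fun_prop

theorem hasDerivAt_gaussWeight_comp (hP : ∀ i j, ContDiff ℝ 1 fun y => P y i j)
    (x z : Fin d → ℝ) (s : ℝ) :
    HasDerivAt (fun s : ℝ => gaussWeight (P (x + s • z)) z)
      (gaussWeight (P (x + s • z)) z *
        (-(z ⬝ᵥ (matrixDeriv P (x + s • z) z *ᵥ z)) / 2)) s := by
  have h : HasDerivAt (fun s : ℝ => z ⬝ᵥ (P (x + s • z) *ᵥ z))
      (z ⬝ᵥ (matrixDeriv P (x + s • z) z *ᵥ z)) s := by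
    simp_rw [quadForm_eq_sum]
    exact HasDerivAt.fun_sum fun a _ => HasDerivAt.fun_sum fun b _ =>
      (hasDerivAt_comp_add_smul ((hP a b).differentiable (by norm_num)) x z s).mul_const _
  exact (h.fun_neg.div_const 2).exp

theorem abs_gaussWeight_comp_sub_le (hP : ∀ i j, ContDiff ℝ 1 fun y => P y i j) {c C : ℝ}
    (hPc : ∀ y z, c * ‖z‖ ^ 2 ≤ z ⬝ᵥ (P y *ᵥ z))
    (hPC : ∀ y z, |z ⬝ᵥ (matrixDeriv P y z *ᵥ z)| ≤ C * ‖z‖ ^ 3) (x z : Fin d → ℝ) (s : ℝ) :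
    |gaussWeight (P (x + s • z)) z - gaussWeight (P x) z|
      ≤ C * ‖z‖ ^ 3 * Real.exp (-(c / 2 * ‖z‖ ^ 2)) * |s| := by
  have h := convex_univ.norm_image_sub_le_of_norm_hasDerivWithin_le
    (f := fun s : ℝ => gaussWeight (P (x + s • z)) z) (x := 0) (y := s)
    (C := C * ‖z‖ ^ 3 * Real.exp (-(c / 2 * ‖z‖ ^ 2)))
    (fun t _ => (hasDerivAt_gaussWeight_comp hP x z t).hasDerivWithinAt)
    (fun t _ => ?_) (Set.mem_univ _) (Set.mem_univ _)
  · simpa using h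
  · have h1 := abs_gaussWeight_le (hPc (x + t • z)) z
    have h2 := hPC (x + t • z) z
    rw [norm_mul, Real.norm_eq_abs, Real.norm_eq_abs, abs_div, abs_neg, abs_two, mul_comm]
    have h3 : |z ⬝ᵥ (matrixDeriv P (x + t • z) z *ᵥ z)| / 2 ≤ C * ‖z‖ ^ 3 := by
      linarith [abs_nonneg (z ⬝ᵥ (matrixDeriv P (x + t • z) z *ᵥ z))]
    exact mul_le_mul h3 h1 (abs_nonneg _) ((abs_nonneg _).trans h2)

theorem tendsto_gaussWeight_comp_slope (hP : ∀ i j, ContDiff ℝ 1 fun y => P y i j)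
    (x z : Fin d → ℝ) :
    Tendsto (fun s : ℝ => (gaussWeight (P (x + s • z)) z - gaussWeight (P x) z) / s) (𝓝[>] 0)
      (𝓝 (gaussWeight (P x) z * (-(z ⬝ᵥ (matrixDeriv P x z *ᵥ z)) / 2))) := by
  have h0 := hasDerivAt_gaussWeight_comp hP x z 0
  rw [zero_smul, add_zero] at h0
  have h := (hasDerivAt_iff_tendsto_slope_zero.1 h0).mono_left
    (nhdsWithin_mono 0 fun s (hs : 0 < s) => hs.ne')
  refine h.congr fun s => ?_
  simp only [zero_add, zero_smul, add_zero, smul_eq_mul]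
  rw [div_eq_inv_mul]

theorem integrable_gaussWeight_comp (hP : ∀ i j, ContDiff ℝ 1 fun y => P y i j) {c : ℝ}
    (hc : 0 < c) (hPc : ∀ y z, c * ‖z‖ ^ 2 ≤ z ⬝ᵥ (P y *ᵥ z)) (x : Fin d → ℝ) (s : ℝ) :
    Integrable fun z => gaussWeight (P (x + s • z)) z := by
  simpa using integrable_of_abs_le_poly_mul_gaussian (n := 0) (K := 1) (φ := fun _ => 1) volume
    (half_pos hc) (continuous_gaussWeight_comp hP x s) continuous_const
    (fun z => abs_gaussWeight_le (hPc (x + s • z)) z) (by simp)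

theorem tendsto_integral_gaussWeight_comp (hP : ∀ i j, ContDiff ℝ 1 fun y => P y i j) {c : ℝ}
    (hc : 0 < c) (hPc : ∀ y z, c * ‖z‖ ^ 2 ≤ z ⬝ᵥ (P y *ᵥ z)) (x : Fin d → ℝ) :
    Tendsto (fun s : ℝ => ∫ z, (gaussWeight (P x) z + gaussWeight (P (x + s • z)) z)) (𝓝[>] 0)
      (𝓝 (2 * ∫ z, gaussWeight (P x) z)) := by
  have hg := integrable_gaussWeight_comp hP hc hPc x 0
  simp only [zero_smul, add_zero] at hg
  simp_rw [two_mul, integral_add hg (integrable_gaussWeight_comp hP hc hPc x _)]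
  refine tendsto_const_nhds.add (tendsto_integral_filter_of_dominated_convergence
    (fun z => (1 + ‖z‖) ^ 0 * Real.exp (-(c / 2 * ‖z‖ ^ 2)))
    (Eventually.of_forall fun s => (continuous_gaussWeight_comp hP x s).aestronglyMeasurable)
    (Eventually.of_forall fun s => Eventually.of_forall fun z => ?_)
    (integrable_one_add_norm_pow_mul_exp_neg_sq volume (half_pos hc) 0)
    (Eventually.of_forall fun z => ?_))
  · simpa using abs_gaussWeight_le (hPc (x + s • z)) z
  · have h := (hasDerivAt_gaussWeight_comp hP x z 0).continuousAt.tendsto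
    simp only [zero_smul, add_zero] at h
    exact h.mono_left nhdsWithin_le_nhds

/-- Second order expansion of the rescaled symmetrized kernel integral. -/
theorem tendsto_integral_symmetrized_gaussWeight (hP : ∀ i j, ContDiff ℝ 1 fun y => P y i j)
    {c C : ℝ} (hc : 0 < c) (hC : 0 ≤ C) (hPc : ∀ y z, c * ‖z‖ ^ 2 ≤ z ⬝ᵥ (P y *ᵥ z))
    (hPC : ∀ y z, |z ⬝ᵥ (matrixDeriv P y z *ᵥ z)| ≤ C * ‖z‖ ^ 3)
    {f : (Fin d → ℝ) → ℝ} (hf : ContDiff ℝ 2 f) (hfc : HasCompactSupport f) (x : Fin d → ℝ) :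
    Tendsto (fun s : ℝ => (∫ z, (gaussWeight (P x) z + gaussWeight (P (x + s • z)) z) *
        (f (x + s • z) - f x)) / s ^ 2) (𝓝[>] 0)
      (𝓝 (∫ z, gaussWeight (P x) z * (-(z ⬝ᵥ (matrixDeriv P x z *ᵥ z)) / 2 * fderiv ℝ f x z
        + fderiv ℝ (fderiv ℝ f) x z z))) := by
  obtain ⟨K, hK0, hK⟩ := exists_abs_taylor_one_remainder_le hf hfc
  set L := fderiv ℝ f x with hL
  set g := gaussWeight (P x) with hg
  set h : ℝ → (Fin d → ℝ) → ℝ := fun s z => gaussWeight (P (x + s • z)) z with hh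
  let G : ℝ → (Fin d → ℝ) → ℝ := fun s z =>
    (h s z - g z) / s * L z + (g z + h s z) * ((f (x + s • z) - f x - s * L z) / s ^ 2)
  have hgc : Continuous g := continuous_gaussWeight
  have hhc : ∀ s, Continuous (h s) := continuous_gaussWeight_comp hP x
  have hfcont := hf.continuous
  have hGc : ∀ s, Continuous (G s) := fun s => by
    have := hhc s
    fun_prop
  have hbound : ∀ s : ℝ, 0 < s → ∀ z, ‖G s z‖ ≤
      (C * ‖L‖ + 2 * K) * ((1 + ‖z‖) ^ 4 * Real.exp (-(c / 2 * ‖z‖ ^ 2))) := by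
    intro s hs z
    set e := Real.exp (-(c / 2 * ‖z‖ ^ 2))
    have he : 0 < e := Real.exp_pos _
    have hz := norm_nonneg z
    have h1 : |(h s z - g z) / s| ≤ C * ‖z‖ ^ 3 * e := by
      rw [abs_div, div_le_iff₀ (abs_pos.2 hs.ne')]
      exact abs_gaussWeight_comp_sub_le hP hPc hPC x z s
    have h2 : |L z| ≤ ‖L‖ * ‖z‖ := L.le_opNorm z
    have h3 : |g z + h s z| ≤ 2 * e := by
      have ha : |g z| ≤ e := abs_gaussWeight_le (hPc x) z
      have hb : |h s z| ≤ e := abs_gaussWeight_le (hPc (x + s • z)) z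
      linarith [abs_add_le (g z) (h s z)]
    have h4 : |(f (x + s • z) - f x - s * L z) / s ^ 2| ≤ K * ‖z‖ ^ 2 := by
      have := hK x (s • z)
      rw [map_smul, smul_eq_mul, norm_smul, mul_pow, Real.norm_eq_abs, sq_abs] at this
      rw [abs_div, abs_of_pos (by positivity : 0 < s ^ 2), div_le_iff₀ (by positivity)]
      linarith
    have h5 : ‖z‖ ^ 2 ≤ (1 + ‖z‖) ^ 4 := by nlinarith [pow_nonneg hz 3, pow_nonneg hz 4]
    have h6 : ‖z‖ ^ 4 ≤ (1 + ‖z‖) ^ 4 := by gcongr; linarith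
    calc ‖G s z‖ ≤ |(h s z - g z) / s * L z|
          + |(g z + h s z) * ((f (x + s • z) - f x - s * L z) / s ^ 2)| := abs_add_le _ _
      _ ≤ (C * ‖z‖ ^ 3 * e) * (‖L‖ * ‖z‖) + (2 * e) * (K * ‖z‖ ^ 2) := by
          rw [abs_mul, abs_mul]
          gcongr
      _ = C * ‖L‖ * (‖z‖ ^ 4 * e) + 2 * K * (‖z‖ ^ 2 * e) := by ring
      _ ≤ C * ‖L‖ * ((1 + ‖z‖) ^ 4 * e) + 2 * K * ((1 + ‖z‖) ^ 4 * e) := by gcongr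
      _ = _ := by ring
  have hbi := (integrable_one_add_norm_pow_mul_exp_neg_sq (E := Fin d → ℝ) volume
    (half_pos hc) 4).const_mul (C * ‖L‖ + 2 * K)
  have hgL : Integrable fun z => g z * L z := by
    refine integrable_of_abs_le_poly_mul_gaussian (n := 1) (K := ‖L‖) volume (half_pos hc) hgc
      L.continuous (abs_gaussWeight_le (hPc x)) fun z => (L.le_opNorm z).trans ?_
    rw [pow_one]
    gcongr
    linarith
  have hodd : ∫ z, g z * L z = 0 := by
    have h1 := integral_neg_eq_self (fun z => g z * L z) volume
    have h2 : ∀ z, g (-z) = g z := fun z => by simp [hg, gaussWeight, mulVec_neg]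
    simp only [h2, map_neg, mul_neg, integral_neg] at h1
    linarith
  have hlim : Tendsto (fun s : ℝ => ∫ z, G s z) (𝓝[>] 0)
      (𝓝 (∫ z, g z * (-(z ⬝ᵥ (matrixDeriv P x z *ᵥ z)) / 2 * L z
        + fderiv ℝ (fderiv ℝ f) x z z))) := by
    refine tendsto_integral_filter_of_dominated_convergence _
      (Eventually.of_forall fun s => (hGc s).aestronglyMeasurable) ?_ hbi
      (Eventually.of_forall fun z => ?_)
    · filter_upwards [self_mem_nhdsWithin] with s hs
      exact Eventually.of_forall (hbound s hs)
    · have h1 := (tendsto_gaussWeight_comp_slope hP x z).mul_const (L z)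
      have h2 := (hasDerivAt_gaussWeight_comp hP x z 0).continuousAt.tendsto
      simp only [zero_smul, add_zero] at h2
      have h3 := ((h2.mono_left nhdsWithin_le_nhds).const_add (g z)).mul (tendsto_taylor_two hf x z)
      convert! h1.add h3 using 2
      ring
  refine hlim.congr' ?_
  filter_upwards [self_mem_nhdsWithin] with s hs
  have hs0 : s ≠ 0 := (show (0 : ℝ) < s from hs).ne'
  have hGi : Integrable (G s) :=
    hbi.mono' (hGc s).aestronglyMeasurable (Eventually.of_forall (hbound s hs))
  have hsplit : ∀ z, (g z + h s z) * (f (x + s • z) - f x) / s ^ 2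
      = G s z + 2 / s * (g z * L z) := fun z => by
    simp only [G]
    field_simp
    ring
  rw [← integral_div]
  change _ = ∫ z, (g z + h s z) * (f (x + s • z) - f x) / s ^ 2
  simp_rw [hsplit]
  rw [integral_add hGi (hgL.const_mul _), integral_const_mul, hodd, mul_zero, add_zero]

end LocalKernel

section Moments

variable {d : ℕ} {P B : Matrix (Fin d) (Fin d) ℝ}

theorem integral_gaussWeight_mul_quad (hsymm : P.IsSymm) (hBP : B * P = 1) {c : ℝ} (hc : 0 < c)
    (hP : ∀ z, c * ‖z‖ ^ 2 ≤ z ⬝ᵥ (P *ᵥ z)) (H : Fin d → Fin d → ℝ) :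
    Integrable (fun z => gaussWeight P z * ∑ i, ∑ j, H i j * (z i * z j)) ∧
    ∫ z, gaussWeight P z * ∑ i, ∑ j, H i j * (z i * z j) =
      (∑ i, ∑ j, H i j * B i j) * ∫ z, gaussWeight P z := by
  have hb := abs_apply_le_one_add_norm (d := d)
  have hInt : ∀ i j, Integrable (fun z : Fin d → ℝ => H i j * (gaussWeight P z * (z i * z j))) :=
    fun i j => (integrable_of_abs_le_poly_mul_gaussian (n := 2) (K := 1) volume (half_pos hc)
      continuous_gaussWeight (by fun_prop) (abs_gaussWeight_le hP) fun z => by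
        rw [abs_mul, sq, one_mul]
        exact mul_le_mul (hb z i) (hb z j) (abs_nonneg _) (by positivity)).const_mul _
  have heq : ∀ z : Fin d → ℝ, gaussWeight P z * ∑ i, ∑ j, H i j * (z i * z j) =
      ∑ i, ∑ j, H i j * (gaussWeight P z * (z i * z j)) := fun z => by
    simp only [Finset.mul_sum]
    exact Finset.sum_congr rfl fun i _ => Finset.sum_congr rfl fun j _ => by ring
  simp_rw [heq]
  have hInt' := fun i => integrable_finsetSum Finset.univ fun j _ => hInt i j
  refine ⟨integrable_finsetSum _ fun i _ => hInt' i, ?_⟩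
  rw [integral_finsetSum _ fun i _ => hInt' i]
  simp_rw [integral_finsetSum _ fun j _ => hInt _ j, integral_const_mul,
    integral_gaussWeight_mul_coord_mul_coord hsymm hBP hc hP, Finset.sum_mul, mul_assoc]

theorem integral_gaussWeight_mul_quartic (hsymm : P.IsSymm) (hBP : B * P = 1) {c : ℝ}
    (hc : 0 < c) (hP : ∀ z, c * ‖z‖ ^ 2 ≤ z ⬝ᵥ (P *ᵥ z))
    (T : Fin d → Fin d → Fin d → Fin d → ℝ) :
    Integrable (fun z => gaussWeight P z *
      ∑ k, ∑ e, ∑ a, ∑ b, T k e a b * (z k * (z a * z b * z e))) ∧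
    ∫ z, gaussWeight P z * ∑ k, ∑ e, ∑ a, ∑ b, T k e a b * (z k * (z a * z b * z e)) =
      (∑ k, ∑ e, ∑ a, ∑ b, T k e a b * (B k a * B b e + B k b * B a e + B k e * B a b)) *
        ∫ z, gaussWeight P z := by
  have hb := abs_apply_le_one_add_norm (d := d)
  have hInt : ∀ k e a b, Integrable (fun z : Fin d → ℝ =>
      T k e a b * (gaussWeight P z * (z k * (z a * z b * z e)))) := fun k e a b =>
    (integrable_of_abs_le_poly_mul_gaussian (n := 4) (K := 1) volume (half_pos hc)
      continuous_gaussWeight (by fun_prop) (abs_gaussWeight_le hP) fun z => by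
        rw [abs_mul, abs_mul, abs_mul, one_mul]
        calc |z k| * (|z a| * |z b| * |z e|)
            ≤ (1 + ‖z‖) * ((1 + ‖z‖) * (1 + ‖z‖) * (1 + ‖z‖)) := by
              gcongr <;> apply hb
          _ = (1 + ‖z‖) ^ 4 := by ring).const_mul _
  have heq : ∀ z : Fin d → ℝ,
      gaussWeight P z * ∑ k, ∑ e, ∑ a, ∑ b, T k e a b * (z k * (z a * z b * z e)) =
      ∑ k, ∑ e, ∑ a, ∑ b, T k e a b * (gaussWeight P z * (z k * (z a * z b * z e))) := fun z => by
    simp only [Finset.mul_sum]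
    exact Finset.sum_congr rfl fun k _ => Finset.sum_congr rfl fun e _ =>
      Finset.sum_congr rfl fun a _ => Finset.sum_congr rfl fun b _ => by ring
  simp_rw [heq]
  have h1 := fun k e a => integrable_finsetSum Finset.univ fun b _ => hInt k e a b
  have h2 := fun k e => integrable_finsetSum Finset.univ fun a _ => h1 k e a
  have h3 := fun k => integrable_finsetSum Finset.univ fun e _ => h2 k e
  refine ⟨integrable_finsetSum _ fun k _ => h3 k, ?_⟩
  rw [integral_finsetSum _ fun k _ => h3 k]
  simp_rw [integral_finsetSum _ fun e _ => h2 _ e, integral_finsetSum _ fun a _ => h1 _ _ a,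
    integral_finsetSum _ fun b _ => hInt _ _ _ b, integral_const_mul,
    integral_gaussWeight_mul_four_coord hsymm hBP hc hP, Finset.sum_mul, mul_assoc]

end Moments

section Coordinates

variable {d : ℕ}

theorem clm_apply_eq_sum (L : (Fin d → ℝ) →L[ℝ] ℝ) (z : Fin d → ℝ) :
    L z = ∑ k, z k * L (Pi.single k 1) := by
  conv_lhs => rw [pi_eq_sum_univ' z]
  simp

theorem fderiv_fderiv_apply_eq_sum {f : (Fin d → ℝ) → ℝ} (hf : ContDiff ℝ 2 f)
    (x z : Fin d → ℝ) :
    fderiv ℝ (fderiv ℝ f) x z z = ∑ i, ∑ j, pd i (pd j f) x * (z i * z j) := by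
  have hpd : ∀ i j, pd i (pd j f) x =
      fderiv ℝ (fderiv ℝ f) x (Pi.single i 1) (Pi.single j 1) := fun i j => by
    have h := ((hf.fderiv_right (m := 1) (by norm_num)).differentiable
      (by norm_num) x).hasFDerivAt.clm_apply (hasFDerivAt_const (Pi.single j (1 : ℝ)) x)
    rw [pd]
    change fderiv ℝ (fun y => fderiv ℝ f y (Pi.single j 1)) x (Pi.single i 1) = _
    rw [h.fderiv]
    simp
  have h1 := clm_apply_eq_sum ((fderiv ℝ (fderiv ℝ f) x).flip z) z
  simp only [ContinuousLinearMap.flip_apply] at h1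
  rw [h1]
  refine Finset.sum_congr rfl fun i _ => ?_
  rw [clm_apply_eq_sum (fderiv ℝ (fderiv ℝ f) x (Pi.single i 1)) z, Finset.mul_sum]
  exact Finset.sum_congr rfl fun j _ => by rw [hpd]; ring

theorem matrixDeriv_eq_sum (M : (Fin d → ℝ) → Matrix (Fin d) (Fin d) ℝ) (x z : Fin d → ℝ)
    (a b : Fin d) : matrixDeriv M x z a b = ∑ e, z e * matrixDeriv M x (Pi.single e 1) a b :=
  clm_apply_eq_sum _ z

/-- Contracting the Gaussian fourth moments with the derivative of the precision matrix. -/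
theorem sum_fourth_moment_contraction {B P D : Matrix (Fin d) (Fin d) ℝ} (hB : B.IsSymm)
    (hD : D.IsSymm) (hBP : B * P = 1) (hPB : P * B = 1) (k e : Fin d) :
    ∑ a, ∑ b, (P * D * P) a b * (B k a * B b e + B k b * B a e + B k e * B a b) =
      2 * D k e + B k e * (P * D).trace := by
  have hPs : P.IsSymm := by
    have h : Pᵀ * B = 1 := by
      have := congrArg Matrix.transpose hBP
      rwa [Matrix.transpose_mul, hB.eq, Matrix.transpose_one] at this
    calc Pᵀ = Pᵀ * (B * P) := by rw [hBP, mul_one]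
      _ = P := by rw [← mul_assoc, h, one_mul]
  set W := P * D * P with hW
  have hWs : W.IsSymm := by
    rw [Matrix.IsSymm, hW, Matrix.transpose_mul, Matrix.transpose_mul, hPs.eq, hD.eq, mul_assoc]
  have hBWB : B * W * B = D := by
    rw [hW]
    calc B * (P * D * P) * B = (B * P) * D * (P * B) := by simp only [mul_assoc]
      _ = D := by rw [hBP, hPB, one_mul, mul_one]
  have h1 : ∑ a, ∑ b, W a b * (B k a * B b e) = D k e := by
    rw [← hBWB, Matrix.mul_apply, Finset.sum_comm]
    simp_rw [Matrix.mul_apply, Finset.sum_mul]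
    exact Finset.sum_congr rfl fun b _ => Finset.sum_congr rfl fun a _ => by ring
  have h2 : ∑ a, ∑ b, W a b * (B k b * B a e) = D k e := by
    rw [← h1, Finset.sum_comm]
    exact Finset.sum_congr rfl fun b _ => Finset.sum_congr rfl fun a _ => by rw [hWs.apply]
  have h3 : ∑ a, ∑ b, W a b * (B k e * B a b) = B k e * (P * D).trace := by
    have : (P * D).trace = (W * B).trace := by
      rw [hW, mul_assoc (P * D), hPB, mul_one]
    rw [this]
    simp only [Matrix.trace, Matrix.diag, Matrix.mul_apply, Finset.mul_sum]
    refine Finset.sum_congr rfl fun a _ => Finset.sum_congr rfl fun b _ => ?_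
    rw [hB.apply a b]
    ring
  simp_rw [mul_add, Finset.sum_add_distrib, h1, h2, h3]
  ring

end Coordinates

section Limit

variable {d : ℕ} {A : (Fin d → ℝ) → Matrix (Fin d) (Fin d) ℝ}

theorem matrixDeriv_isSymm (hA : ∀ y, (A y).PosDef) (x v : Fin d → ℝ) :
    (matrixDeriv A x v).IsSymm := by
  ext i j
  have : (fun y => A y j i) = fun y => A y i j := by
    ext y
    simpa using (hA y).isHermitian.apply i j
  simp [matrixDeriv, this]

theorem integral_limit_eq (hApos : ∀ y, (A y).PosDef)
    (hA : ∀ i j, ContDiff ℝ 1 fun y => A y i j) {c : ℝ} (hc : 0 < c) (x : Fin d → ℝ)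
    (hP : ∀ z, c * ‖z‖ ^ 2 ≤ z ⬝ᵥ ((A x)⁻¹ *ᵥ z)) {f : (Fin d → ℝ) → ℝ} (hf : ContDiff ℝ 2 f) :
    ∫ z, gaussWeight (A x)⁻¹ z *
      (-(z ⬝ᵥ (matrixDeriv (fun y => (A y)⁻¹) x z *ᵥ z)) / 2 * fderiv ℝ f x z
        + fderiv ℝ (fderiv ℝ f) x z z) =
    (∑ i, ∑ j, (((A x)⁻¹ * matrixDeriv A x (Pi.single i 1)).trace / 2 * A x i j * pd j f x
      + matrixDeriv A x (Pi.single i 1) i j * pd j f x + A x i j * pd i (pd j f) x)) *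
      ∫ z, gaussWeight (A x)⁻¹ z := by
  have hu : IsUnit (A x).det := (hApos x).det_pos.ne'.isUnit
  have hBs : (A x).IsSymm := by
    rw [Matrix.IsSymm]
    simpa using (hApos x).isHermitian.eq
  set P := (A x)⁻¹ with hPdef
  have hBP : A x * P = 1 := Matrix.mul_nonsing_inv _ hu
  have hPB : P * A x = 1 := Matrix.nonsing_inv_mul _ hu
  have hPs : P.IsSymm := by
    rw [Matrix.IsSymm, hPdef, Matrix.transpose_nonsing_inv, hBs.eq]
  set D : Fin d → Matrix (Fin d) (Fin d) ℝ := fun e => matrixDeriv A x (Pi.single e 1) with hD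
  have hcubic : ∀ z, -(z ⬝ᵥ (matrixDeriv (fun y => (A y)⁻¹) x z *ᵥ z)) / 2 * fderiv ℝ f x z =
      ∑ k, ∑ e, ∑ a, ∑ b, (pd k f x / 2 * (P * D e * P) a b) * (z k * (z a * z b * z e)) := by
    intro z
    have h1 : z ⬝ᵥ (matrixDeriv (fun y => (A y)⁻¹) x z *ᵥ z) =
        -∑ e, ∑ a, ∑ b, (P * D e * P) a b * (z a * z b * z e) := by
      have hentry : ∀ a b, matrixDeriv (fun y => (A y)⁻¹) x z a b =
          -∑ e, z e * (P * D e * P) a b := fun a b => by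
        rw [matrixDeriv_eq_sum, ← Finset.sum_neg_distrib]
        refine Finset.sum_congr rfl fun e _ => ?_
        rw [matrixDeriv_inv hA fun y => (hApos y).det_pos.ne', Matrix.neg_apply, mul_neg]
      have hswap : ∑ e, ∑ a, ∑ b, (P * D e * P) a b * (z a * z b * z e) =
          ∑ a, ∑ b, ∑ e, (P * D e * P) a b * (z a * z b * z e) := by
        rw [Finset.sum_comm]
        exact Finset.sum_congr rfl fun a _ => Finset.sum_comm
      rw [quadForm_eq_sum, hswap, ← Finset.sum_neg_distrib]
      refine Finset.sum_congr rfl fun a _ => ?_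
      rw [← Finset.sum_neg_distrib]
      refine Finset.sum_congr rfl fun b _ => ?_
      rw [hentry, neg_mul, Finset.sum_mul]
      congr 1
      exact Finset.sum_congr rfl fun e _ => by ring
    rw [h1, neg_neg, clm_apply_eq_sum (fderiv ℝ f x) z, Finset.mul_sum]
    refine Finset.sum_congr rfl fun k _ => ?_
    simp only [Finset.sum_div, Finset.sum_mul]
    refine Finset.sum_congr rfl fun e _ => Finset.sum_congr rfl fun a _ =>
      Finset.sum_congr rfl fun b _ => ?_
    rw [pd]
    ring
  obtain ⟨hi4, h4⟩ := integral_gaussWeight_mul_quartic hPs hBP hc hP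
    fun k e a b => pd k f x / 2 * (P * D e * P) a b
  obtain ⟨hi2, h2⟩ := integral_gaussWeight_mul_quad hPs hBP hc hP fun i j => pd i (pd j f) x
  simp_rw [hcubic, fderiv_fderiv_apply_eq_sum hf, mul_add]
  rw [integral_add hi4 hi2, h4, h2, ← add_mul]
  congr 1
  have hcontr : ∀ k e, ∑ a, ∑ b, pd k f x / 2 * (P * D e * P) a b *
      (A x k a * A x b e + A x k b * A x a e + A x k e * A x a b) =
      pd k f x / 2 * (2 * D e k e + A x k e * (P * D e).trace) := fun k e => by
    rw [← sum_fourth_moment_contraction hBs (matrixDeriv_isSymm hApos x _) hBP hPB]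
    simp only [Finset.mul_sum]
    exact Finset.sum_congr rfl fun a _ => Finset.sum_congr rfl fun b _ => mul_assoc _ _ _
  simp_rw [hcontr]
  rw [Finset.sum_comm, ← Finset.sum_add_distrib]
  refine Finset.sum_congr rfl fun e _ => ?_
  rw [← Finset.sum_add_distrib]
  refine Finset.sum_congr rfl fun k _ => ?_
  have hDs : D e k e = D e e k := (matrixDeriv_isSymm hApos x _).apply e k
  rw [hBs.apply e k, hDs]
  ring

theorem divergence_form_eq (hApos : ∀ y, (A y).PosDef)
    (hA : ∀ i j, ContDiff ℝ 1 fun y => A y i j) {f : (Fin d → ℝ) → ℝ} (hf : ContDiff ℝ 2 f)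
    {q : (Fin d → ℝ) → ℝ} (hq : ∀ y, q y = √(A y).det) (x : Fin d → ℝ) (i j : Fin d) :
    pd i (fun y => q y * A y i j * pd j f y) x = q x *
      (((A x)⁻¹ * matrixDeriv A x (Pi.single i 1)).trace / 2 * A x i j * pd j f x
      + matrixDeriv A x (Pi.single i 1) i j * pd j f x + A x i j * pd i (pd j f) x) := by
  have hdet := (hApos x).det_pos
  have hdiff : DifferentiableAt ℝ (fun y => (A y).det) x :=
    (contDiff_matrix_det hA).differentiable (by norm_num) x
  have hq' : HasFDerivAt q ((1 / (2 * √(A x).det)) • fderiv ℝ (fun y => (A y).det) x) x := by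
    rw [funext hq]
    exact hdiff.hasFDerivAt.sqrt hdet.ne'
  have hpd : DifferentiableAt ℝ (pd j f) x :=
    ((hf.fderiv_right (m := 1) (by norm_num)).differentiable (by norm_num) x).clm_apply
      (differentiableAt_const _)
  have h := (hq'.fun_mul ((hA i j).differentiable (by norm_num) x).hasFDerivAt).fun_mul
    hpd.hasFDerivAt
  rw [pd, h.fderiv]
  simp only [FunLike.coe_add, FunLike.coe_smul, Pi.add_apply, Pi.smul_apply, smul_eq_mul]
  rw [fderiv_det (fun i j => (hA i j).differentiable (by norm_num) x) hdet.ne', hq x]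
  have hs : √(A x).det ≠ 0 := (Real.sqrt_pos.2 hdet).ne'
  have hsq := Real.mul_self_sqrt hdet.le
  have hhalf : 1 / (2 * √(A x).det) * ((A x).det *
      ((A x)⁻¹ * matrixDeriv A x (Pi.single i 1)).trace) =
      √(A x).det * ((A x)⁻¹ * matrixDeriv A x (Pi.single i 1)).trace / 2 := by
    field_simp
    rw [Real.sq_sqrt hdet.le]
  rw [hhalf]
  simp only [matrixDeriv, Matrix.of_apply, pd]
  ring

theorem abs_matrixDeriv_inv_quadForm_le (hApos : ∀ y, (A y).PosDef)
    (hA : ∀ i j, ContDiff ℝ 1 fun y => A y i j) {lam : ℝ} (hlam : 0 < lam)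
    (hb : ∀ y v, lam * ∑ i, v i ^ 2 ≤ v ⬝ᵥ (A y *ᵥ v)) {M : ℝ} (hM0 : 0 ≤ M)
    (hM : ∀ i j y, ‖fderiv ℝ (fun z => A z i j) y‖ ≤ M) (y z : Fin d → ℝ) :
    |z ⬝ᵥ (matrixDeriv (fun y => (A y)⁻¹) y z *ᵥ z)| ≤
      (d ^ 4 * lam⁻¹ ^ 2 * M) * ‖z‖ ^ 3 := by
  have hD : ∀ i j, |matrixDeriv A y z i j| ≤ M * ‖z‖ := fun i j =>
    (fderiv ℝ (fun z => A z i j) y).le_of_opNorm_le (hM i j y) z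
  have hPb := fun i j => abs_inv_apply_le (hApos y) hlam (hb y) i j
  have hz : ∀ i, |z i| ≤ ‖z‖ := fun i => norm_le_pi_norm z i
  have h1 : ∀ i j, |((A y)⁻¹ * matrixDeriv A y z) i j| ≤ d * (lam⁻¹ * (M * ‖z‖)) := fun i j => by
    rw [Matrix.mul_apply]
    refine (Finset.abs_sum_le_sum_abs _ _).trans
      ((Finset.sum_le_card_nsmul _ _ (lam⁻¹ * (M * ‖z‖)) fun k _ => ?_).trans (by simp))
    rw [abs_mul]
    exact mul_le_mul (hPb i k) (hD k j) (abs_nonneg _) (by positivity)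
  have h2 : ∀ i j, |matrixDeriv (fun y => (A y)⁻¹) y z i j| ≤
      d * (d * (lam⁻¹ * (M * ‖z‖)) * lam⁻¹) := fun i j => by
    rw [matrixDeriv_inv hA (fun y => (hApos y).det_pos.ne'), Matrix.neg_apply, abs_neg,
      Matrix.mul_apply]
    refine (Finset.abs_sum_le_sum_abs _ _).trans
      ((Finset.sum_le_card_nsmul _ _ (d * (lam⁻¹ * (M * ‖z‖)) * lam⁻¹) fun k _ => ?_).trans
        (by simp))
    rw [abs_mul]
    exact mul_le_mul (h1 i k) (hPb k j) (abs_nonneg _) (by positivity)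
  rw [quadForm_eq_sum]
  calc _ ≤ ∑ a : Fin d, ∑ b : Fin d,
        d * (d * (lam⁻¹ * (M * ‖z‖)) * lam⁻¹) * (‖z‖ * ‖z‖) := by
        refine (Finset.abs_sum_le_sum_abs _ _).trans (Finset.sum_le_sum fun a _ =>
          (Finset.abs_sum_le_sum_abs _ _).trans (Finset.sum_le_sum fun b _ => ?_))
        rw [abs_mul, abs_mul]
        have := h2 a b
        gcongr <;> apply hz
    _ = _ := by
        simp only [Finset.sum_const, Finset.card_univ, Fintype.card_fin, nsmul_eq_mul]
        ring

theorem integral_eq_pow_mul_integral_add_smul (F : (Fin d → ℝ) → ℝ) (x : Fin d → ℝ) {s : ℝ}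
    (hs : 0 < s) : ∫ y, F y = s ^ d * ∫ z, F (x + s • z) := by
  rw [Measure.integral_comp_smul_of_nonneg volume (fun z => F (x + z)) s (hR := hs.le),
    integral_add_left_eq_self]
  have : s ^ d ≠ 0 := by positivity
  simp [this]

end Limit

/-- Euclidean case of the expansion of symmetric local kernels: the left-normalized
symmetrized prototypical kernel converges to the divergence-form elliptic operator
`(1/(2q)) ∑ᵢⱼ ∂ᵢ(q·Aᵢⱼ·∂ⱼf)` with `q = (det A)^(1/2)`. -/
theorem symmetric_kernel_converges_to_weighted_laplacian
    (d : ℕ) (hd : 1 ≤ d)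
    (A : (Fin d → ℝ) → Matrix (Fin d) (Fin d) ℝ) (hApos : ∀ y, (A y).PosDef)
    (hAsmooth : ∀ i j, ContDiff ℝ (⊤ : ℕ∞) (fun y => A y i j))
    (lam Λ : ℝ) (hlam : 0 < lam) (hlamΛ : lam ≤ Λ)
    (hbound : ∀ (y : Fin d → ℝ) (v : Fin d → ℝ),
      lam * (∑ i, v i ^ 2) ≤ v ⬝ᵥ (A y *ᵥ v) ∧ v ⬝ᵥ (A y *ᵥ v) ≤ Λ * (∑ i, v i ^ 2))
    (hAderivbdd : ∀ n : ℕ, 1 ≤ n → ∀ i j,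
      ∃ M : ℝ, ∀ y, ‖iteratedFDeriv ℝ n (fun z => A z i j) y‖ ≤ M)
    (f : (Fin d → ℝ) → ℝ) (hf : ContDiff ℝ (⊤ : ℕ∞) f) (hfc : HasCompactSupport f)
    (Kbar : ℝ → (Fin d → ℝ) → (Fin d → ℝ) → ℝ)
    (hKbar : ∀ ε x y, Kbar ε x y =
      Real.exp (-((y - x) ⬝ᵥ ((A x)⁻¹ *ᵥ (y - x))) / (2 * ε)) +
      Real.exp (-((y - x) ⬝ᵥ ((A y)⁻¹ *ᵥ (y - x))) / (2 * ε)))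
    (q : (Fin d → ℝ) → ℝ) (hq : ∀ y, q y = Real.sqrt (A y).det)
    (x : Fin d → ℝ) :
    Filter.Tendsto
      (fun ε : ℝ =>
        (1 / ε) *
          ((∫ y : Fin d → ℝ, Kbar ε x y * f y) / (∫ y : Fin d → ℝ, Kbar ε x y) - f x))
      (nhdsWithin 0 (Set.Ioi 0))
      (nhds ((1 / (2 * q x)) *
        ∑ i, ∑ j, pd i (fun y => q y * A y i j * pd j f y) x)) := by
  have hΛ : 0 < Λ := hlam.trans_le hlamΛ
  have hA1 : ∀ i j, ContDiff ℝ 1 fun y => A y i j := fun i j => contDiff_infty.1 (hAsmooth i j) 1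
  have hf2 : ContDiff ℝ 2 f := contDiff_infty.1 hf 2
  have hdet : ∀ y, (A y).det ≠ 0 := fun y => (hApos y).det_pos.ne'
  have hP1 : ∀ i j, ContDiff ℝ 1 fun y => (A y)⁻¹ i j := contDiff_matrix_inv hA1 hdet
  have hc : 0 < Λ⁻¹ := inv_pos.2 hΛ
  have hPc : ∀ y z, Λ⁻¹ * ‖z‖ ^ 2 ≤ z ⬝ᵥ ((A y)⁻¹ *ᵥ z) := fun y z =>
    inv_quadForm_lower_bound (hApos y) hΛ (fun v => (hbound y v).2) z
  obtain ⟨M, hM0, hM⟩ : ∃ M : ℝ, 0 ≤ M ∧ ∀ i j y, ‖fderiv ℝ (fun z => A z i j) y‖ ≤ M := by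
    choose N hN using hAderivbdd 1 le_rfl
    have hN' : ∀ i j y, ‖fderiv ℝ (fun z => A z i j) y‖ ≤ N i j := fun i j y => by
      rw [← norm_iteratedFDeriv_one]
      exact hN i j y
    have hN0 : ∀ i j, 0 ≤ N i j := fun i j => (norm_nonneg _).trans (hN' i j 0)
    refine ⟨∑ i, ∑ j, N i j, Finset.sum_nonneg fun i _ => Finset.sum_nonneg fun j _ => hN0 i j,
      fun i j y => (hN' i j y).trans ?_⟩
    exact (Finset.single_le_sum (fun j _ => hN0 i j) (Finset.mem_univ j)).trans
      (Finset.single_le_sum (f := fun i => ∑ j, N i j)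
        (fun i _ => Finset.sum_nonneg fun j _ => hN0 i j) (Finset.mem_univ i))
  have hnum := tendsto_integral_symmetrized_gaussWeight hP1 hc (by positivity) hPc
    (abs_matrixDeriv_inv_quadForm_le hApos hA1 hlam (fun y v => (hbound y v).1) hM0 hM)
    hf2 hfc x
  have hden := tendsto_integral_gaussWeight_comp hP1 hc hPc x
  rw [integral_limit_eq hApos hA1 hc x (hPc x) hf2] at hnum
  have hg := integrable_gaussWeight_comp hP1 hc hPc x
  have hg0 := hg 0
  simp only [zero_smul, add_zero] at hg0
  have hI0 : 0 < ∫ z, gaussWeight (A x)⁻¹ z := integral_exp_pos hg0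
  have hqx : q x ≠ 0 := by
    rw [hq]
    exact (Real.sqrt_pos.2 (hApos x).det_pos).ne'
  have hlim := hnum.div hden (by positivity)
  have hsqrt : Tendsto Real.sqrt (𝓝[>] 0) (𝓝[>] 0) := by
    refine tendsto_nhdsWithin_iff.2 ⟨?_, ?_⟩
    · simpa using (Real.continuous_sqrt.tendsto 0).mono_left nhdsWithin_le_nhds
    · filter_upwards [self_mem_nhdsWithin] with ε hε
      exact Real.sqrt_pos.2 hε
  convert! (hlim.comp hsqrt).congr' ?_ using 2
  · simp_rw [divergence_form_eq hApos hA1 hf2 hq, ← Finset.mul_sum]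
    field_simp
  · filter_upwards [self_mem_nhdsWithin] with ε hε
    have hε0 : (0 : ℝ) < ε := hε
    set s := √ε with hs
    have hs0 : 0 < s := Real.sqrt_pos.2 hε0
    have hsε : ε = s ^ 2 := (Real.sq_sqrt hε0.le).symm
    have hK : ∀ z, Kbar ε x (x + s • z) =
        gaussWeight (A x)⁻¹ z + gaussWeight (A (x + s • z))⁻¹ z := fun z => by
      have hquad : ∀ N : Matrix (Fin d) (Fin d) ℝ,
          -((s • z) ⬝ᵥ (N *ᵥ (s • z))) / (2 * ε) = -(z ⬝ᵥ (N *ᵥ z)) / 2 := fun N => by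
        rw [mulVec_smul, smul_dotProduct, dotProduct_smul, hsε]
        simp only [smul_eq_mul]
        field_simp
      rw [hKbar, add_sub_cancel_left, hquad, hquad, gaussWeight, gaussWeight]
    have hki : Integrable fun z => gaussWeight (A x)⁻¹ z + gaussWeight (A (x + s • z))⁻¹ z :=
      hg0.add (hg s)
    have hkf : Integrable fun z =>
        (gaussWeight (A x)⁻¹ z + gaussWeight (A (x + s • z))⁻¹ z) * f (x + s • z) := by
      obtain ⟨C, hC⟩ := hfc.exists_bound_of_continuous hf.continuous
      have hcont : Continuous fun z => f (x + s • z) := hf.continuous.comp (by fun_prop)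
      exact hki.mul_bdd hcont.aestronglyMeasurable (Eventually.of_forall fun z => hC _)
    have hDpos : 0 < ∫ z, (gaussWeight (A x)⁻¹ z + gaussWeight (A (x + s • z))⁻¹ z) := by
      rw [integral_add hg0 (hg s)]
      exact add_pos hI0 (integral_exp_pos (hg s))
    have hsplit : ∫ z, (gaussWeight (A x)⁻¹ z + gaussWeight (A (x + s • z))⁻¹ z) *
          (f (x + s • z) - f x) =
        (∫ z, (gaussWeight (A x)⁻¹ z + gaussWeight (A (x + s • z))⁻¹ z) * f (x + s • z)) -
          (∫ z, (gaussWeight (A x)⁻¹ z + gaussWeight (A (x + s • z))⁻¹ z)) * f x := by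
      simp_rw [mul_sub]
      rw [integral_sub hkf (hki.mul_const _), integral_mul_const]
    have hpow : s ^ d ≠ 0 := by positivity
    simp only [Function.comp_apply, Pi.div_apply]
    rw [← hs, hsplit, integral_eq_pow_mul_integral_add_smul (fun y => Kbar ε x y * f y) x hs0,
      integral_eq_pow_mul_integral_add_smul (fun y => Kbar ε x y) x hs0]
    simp_rw [hK]
    rw [hsε, mul_div_mul_left _ _ hpow]
    field_simp
end
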